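/- Suppose s⋆²·log p ≤ n and p ≥ 3. There exists a universal constant K_∞ > 0 (not depending on n, p, or s⋆) such that with probability at least 1 − 6·p^{−s⋆}, for every S ∈ 𝒮_{s⋆} the matrix X_SᵀX_S is invertible and ‖(X_SᵀX_S)^{−1}‖_∞ ≤ K_∞/n. -/

import Mathlib

open MeasureTheory ProbabilityTheory Matrix Real

/-- The law of an `n × p` matrix with i.i.d. standard normal entries. -/
noncomputable def gaussMat (n p : ℕ) : Measure (Fin n → Fin p → ℝ) :=
  Measure.pi fun _ : Fin n => Measure.pi fun _ : Fin p => gaussianReal 0 1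

/-- Unweighted Gram matrix `X_SᵀX_S = ∑ᵢ X_{i,S} X_{i,S}ᵀ`. -/
noncomputable def gram {n p : ℕ} (S : Finset (Fin p)) (x : Fin n → Fin p → ℝ) :
    Matrix S S ℝ :=
  Matrix.of fun j k => ∑ i, x i j.1 * x i k.1

/-- Matrix `ℓ∞→ℓ∞` operator norm, `‖A‖_∞ = max_i ∑_j |a_{ij}|`. -/
noncomputable def matNormInf {m : Type*} [Fintype m] (A : Matrix m m ℝ) : ℝ :=
  ⨆ i : m, ∑ j, |A i j|

theorem integral_exp_mul_sq_gaussianReal {l : ℝ} (hl : l < 1 / 2) :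
    ∫ z, exp (l * z ^ 2) ∂gaussianReal 0 1 = (√(1 - 2 * l))⁻¹ := by
  rw [integral_gaussianReal_eq_integral_smul one_ne_zero]
  have h : ∀ z : ℝ, gaussianPDFReal 0 1 z • exp (l * z ^ 2)
      = (√(2 * π))⁻¹ * exp (-(1 / 2 - l) * z ^ 2) := by
    intro z
    simp only [gaussianPDFReal, smul_eq_mul, NNReal.coe_one, mul_one, sub_zero]
    rw [mul_assoc, ← exp_add]
    congr 2
    ring
  simp_rw [h]
  rw [integral_const_mul, integral_gaussian, ← sqrt_inv, ← sqrt_inv, ← sqrt_mul (by positivity)]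
  congr 1
  have : 1 - 2 * l ≠ 0 := by linarith
  have : 1 / 2 - l ≠ 0 := by linarith
  field_simp

theorem map_dot_pi_gaussianReal {p : ℕ} (u : EuclideanSpace ℝ (Fin p)) (hu : ‖u‖ = 1) :
    (Measure.pi fun _ : Fin p => gaussianReal 0 1).map (fun y => ∑ j, y j * u j)
      = gaussianReal 0 1 := by
  have h := IsGaussian.map_eq_gaussianReal (μ := stdGaussian (EuclideanSpace ℝ (Fin p)))
    (innerSL ℝ u)
  rw [integral_strongDual_stdGaussian, variance_dual_stdGaussian, innerSL_apply_norm, hu,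
    ← map_pi_eq_stdGaussian, Measure.map_map (by fun_prop) (by fun_prop)] at h
  simpa [Function.comp_def, PiLp.inner_apply] using h

theorem integral_exp_mul_norm_sq_gaussMat {n p : ℕ} (u : EuclideanSpace ℝ (Fin p)) (hu : ‖u‖ = 1)
    {l : ℝ} (hl : l < 1 / 2) :
    ∫ x, exp (l * ‖toEuclideanLin (of x) u‖ ^ 2) ∂gaussMat n p = (√(1 - 2 * l))⁻¹ ^ n := by
  have h : ∀ x : Fin n → Fin p → ℝ, exp (l * ‖toEuclideanLin (of x) u‖ ^ 2)
      = ∏ i, exp (l * (∑ j, x i j * u j) ^ 2) := by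
    intro x
    rw [EuclideanSpace.real_norm_sq_eq, Finset.mul_sum, exp_sum]
    simp [toLpLin_apply, mulVec, dotProduct]
  have hrow : ∫ y : Fin p → ℝ, exp (l * (∑ j, y j * u j) ^ 2)
      ∂Measure.pi (fun _ => gaussianReal 0 1) = (√(1 - 2 * l))⁻¹ := by
    have h1 := integral_exp_mul_sq_gaussianReal hl
    rwa [← map_dot_pi_gaussianReal u hu,
      integral_map (Measurable.aemeasurable (by fun_prop)) (by fun_prop)] at h1
  simp_rw [h]
  rw [gaussMat, integral_fintype_prod_eq_prod
    (f := fun _ (y : Fin p → ℝ) => exp (l * (∑ j, y j * u j) ^ 2))]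
  simp [hrow]

theorem gaussMat_real_mul_le_mul_norm_sq {n p : ℕ} (u : EuclideanSpace ℝ (Fin p)) (hu : ‖u‖ = 1)
    {l : ℝ} (hl : l < 1 / 2) (a : ℝ) :
    (gaussMat n p).real {x | l * a ≤ l * ‖toEuclideanLin (of x) u‖ ^ 2}
      ≤ exp (-(l * a)) * (√(1 - 2 * l))⁻¹ ^ n := by
  have hI := integral_exp_mul_norm_sq_gaussMat (n := n) u hu hl
  have h0 : 0 < (√(1 - 2 * l))⁻¹ ^ n := by
    have : 0 < 1 - 2 * l := by linarith
    positivity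
  have hint : Integrable (fun x => exp (l * ‖toEuclideanLin (of x) u‖ ^ 2)) (gaussMat n p) :=
    not_imp_comm.1 integral_undef (by rw [hI]; exact h0.ne')
  have := mul_meas_ge_le_integral_of_nonneg (.of_forall fun x => (exp_pos _).le) hint (exp (l * a))
  rw [hI] at this
  simp only [exp_le_exp] at this
  rw [exp_neg, inv_mul_eq_div, le_div_iff₀ (exp_pos _), mul_comm]
  exact this

theorem inv_sqrt_one_sub_le_exp {l : ℝ} (hl : l ≤ 1 / 4) :
    (√(1 - 2 * l))⁻¹ ≤ exp (l + 4 * l ^ 2) := by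
  have h1 : 0 < 1 - 2 * l := by linarith
  have h2 : -(2 * l + 8 * l ^ 2) ≤ log (1 - 2 * l) := by
    refine le_trans ?_ (one_sub_inv_le_log_of_pos h1)
    have : (1 - 2 * l)⁻¹ ≤ 1 + 2 * l + 8 * l ^ 2 := by
      rw [inv_le_iff_one_le_mul₀ h1]
      nlinarith [sq_nonneg l]
    linarith
  rw [inv_le_comm₀ (by positivity) (exp_pos _), ← exp_neg]
  apply le_sqrt_of_sq_le
  rw [← exp_nat_mul, ← le_log_iff_exp_le h1]
  push_cast
  linarith

theorem gaussMat_real_mul_le_mul_norm_sq_of_le {n p : ℕ} (u : EuclideanSpace ℝ (Fin p))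
    (hu : ‖u‖ = 1) {l : ℝ} (hl : l ≤ 1 / 4) (a : ℝ) :
    (gaussMat n p).real {x | l * a ≤ l * ‖toEuclideanLin (of x) u‖ ^ 2}
      ≤ exp (n * (l + 4 * l ^ 2) - l * a) := by
  refine (gaussMat_real_mul_le_mul_norm_sq u hu (by linarith) a).trans ?_
  rw [sub_eq_neg_add ((n : ℝ) * _), exp_add, exp_nat_mul]
  gcongr
  exact inv_sqrt_one_sub_le_exp hl

/-- A vector of integers, seen as a Euclidean vector. -/
noncomputable def intVec {p : ℕ} (a : Fin p → ℤ) : EuclideanSpace ℝ (Fin p) :=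
  WithLp.toLp 2 fun j => (a j : ℝ)

/-- The integer vectors supported on `S` with entries in `[-M, M]`. -/
noncomputable def latticeNet {p : ℕ} (S : Finset (Fin p)) (M : ℕ) : Finset (Fin p → ℤ) :=
  Fintype.piFinset fun j => if j ∈ S then Finset.Icc (-(M : ℤ)) M else {0}

theorem card_latticeNet {p : ℕ} (S : Finset (Fin p)) (M : ℕ) :
    (latticeNet S M).card = (2 * M + 1) ^ S.card := by
  have h (j : Fin p) : (if j ∈ S then Finset.Icc (-(M : ℤ)) M else {0}).card
      = if j ∈ S then 2 * M + 1 else 1 := by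
    split_ifs
    · rw [Int.card_Icc]; omega
    · simp
  simp [latticeNet, Fintype.card_piFinset, h]

theorem exists_latticeNet_near {p : ℕ} {S : Finset (Fin p)} {v : EuclideanSpace ℝ (Fin p)}
    (hv : ‖v‖ = 1) (hS : ∀ j ∉ S, v j = 0) (M : ℕ) :
    ∃ a ∈ latticeNet S M, (∀ j, v j = 0 → a j = 0) ∧
      ∀ j, |(intVec a - (M : ℝ) • v) j| ≤ 1 / 2 := by
  refine ⟨fun j => round (M * v j), ?_, fun j hj => by simp [hj], fun j => ?_⟩
  · rw [latticeNet, Fintype.mem_piFinset]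
    intro j
    split_ifs with hj
    · have hj' : |v j| ≤ 1 := by simpa [hv] using PiLp.norm_apply_le v j
      have hM : |(M : ℝ) * v j| ≤ M := by
        rw [abs_mul, Nat.abs_cast]
        exact mul_le_of_le_one_right (Nat.cast_nonneg _) hj'
      have hr := abs_le.1 (abs_sub_round ((M : ℝ) * v j))
      have hM' := abs_le.1 hM
      rw [Finset.mem_Icc, ← Int.lt_add_one_iff, ← Int.sub_one_lt_iff, ← Int.cast_lt (R := ℝ),
        ← Int.cast_lt (R := ℝ)]
      push_cast
      constructor <;> linarith
    · simp [hS j hj]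
  · simpa [intVec, abs_sub_comm] using abs_sub_round ((M : ℝ) * v j)

section Deterministic

variable {p : ℕ} {F : Type*} [NormedAddCommGroup F] [InnerProductSpace ℝ F]

theorem map_eq_sum_smul_single (T : EuclideanSpace ℝ (Fin p) →ₗ[ℝ] F)
    (v : EuclideanSpace ℝ (Fin p)) : T v = ∑ j, v j • T (EuclideanSpace.single j 1) := by
  conv_lhs => rw [← (EuclideanSpace.basisFun (Fin p) ℝ).sum_repr v]
  simp

theorem norm_map_le_of_abs_le_half {T : EuclideanSpace ℝ (Fin p) →ₗ[ℝ] F} {B : ℝ}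
    (hT : ∀ j, ‖T (EuclideanSpace.single j 1)‖ ≤ B) {S : Finset (Fin p)}
    {d : EuclideanSpace ℝ (Fin p)} (hS : ∀ j ∉ S, d j = 0) (hd : ∀ j, |d j| ≤ 1 / 2) :
    ‖T d‖ ≤ S.card * (B / 2) := by
  rw [map_eq_sum_smul_single, ← Finset.sum_subset S.subset_univ (by
    intro j _ hj; simp [hS j hj])]
  refine norm_sum_le_of_le _ (fun j _ => ?_) |>.trans (by simp : ∑ j ∈ S, B / 2 ≤ _)
  rw [norm_smul, Real.norm_eq_abs]
  have := mul_le_mul (hd j) (hT j) (norm_nonneg _) (by norm_num)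
  linarith

theorem norm_le_of_abs_le_half {S : Finset (Fin p)}
    {d : EuclideanSpace ℝ (Fin p)} (hS : ∀ j ∉ S, d j = 0) (hd : ∀ j, |d j| ≤ 1 / 2) :
    ‖d‖ ≤ S.card / 2 := by
  have := norm_map_le_of_abs_le_half (T := LinearMap.id) (B := 1) (by simp) hS hd
  simpa [div_eq_mul_inv] using this

theorem le_norm_map_of_latticeNet {T : EuclideanSpace ℝ (Fin p) →ₗ[ℝ] F} {b : ℝ} (hb : 0 ≤ b)
    (hT : ∀ j, ‖T (EuclideanSpace.single j 1)‖ ≤ 4 * b) {S : Finset (Fin p)}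
    (hS0 : S.Nonempty) {q : ℕ} (hq : 0 < q)
    (hnet : ∀ a ∈ latticeNet S (8 * q * S.card), a ≠ 0 → b / q * ‖intVec a‖ ≤ ‖T (intVec a)‖)
    {v : EuclideanSpace ℝ (Fin p)} (hS : ∀ j ∉ S, v j = 0) :
    b / (4 * q) * ‖v‖ ≤ ‖T v‖ := by
  rcases eq_or_ne v 0 with rfl | hv
  · simp
  have hv0 : 0 < ‖v‖ := norm_pos_iff.2 hv
  set u := ‖v‖⁻¹ • v with hu
  have hu1 : ‖u‖ = 1 := by simp [hu, norm_smul, hv0.ne']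
  have huS : ∀ j ∉ S, u j = 0 := fun j hj => by simp [hu, hS j hj]
  suffices h : b / (4 * q) ≤ ‖T u‖ by
    have h' : ‖T u‖ = ‖v‖⁻¹ * ‖T v‖ := by simp [hu, norm_smul]
    rw [h', inv_mul_eq_div, le_div_iff₀ hv0] at h
    exact h
  obtain ⟨a, ha, hau, hd⟩ := exists_latticeNet_near hu1 huS (8 * q * S.card)
  set M : ℝ := ((8 * q * S.card : ℕ) : ℝ) with hM
  have hMv : M = 8 * q * S.card := by simp [hM]
  have hdS : ∀ j ∉ S, (intVec a - M • u) j = 0 := fun j hj => by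
    simp [intVec, huS j hj, hau j (huS j hj)]
  have h1 := norm_map_le_of_abs_le_half hT hdS hd
  have h2 := norm_le_of_abs_le_half hdS hd
  have hs : (1 : ℝ) ≤ S.card := by exact_mod_cast hS0.card_pos
  have hq' : (1 : ℝ) ≤ q := by exact_mod_cast hq
  have hMu : ‖M • u‖ = M := by rw [norm_smul, hu1, mul_one, Real.norm_of_nonneg (by positivity)]
  have h3 : M / 2 ≤ ‖intVec a‖ := by
    have := norm_sub_norm_le (M • u) (intVec a)
    rw [norm_sub_rev, hMu] at this
    nlinarith
  have ha0 : a ≠ 0 := by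
    rintro rfl
    have : intVec (0 : Fin p → ℤ) = 0 := by ext j; simp [intVec]
    rw [this, norm_zero] at h3
    nlinarith
  have h4 := hnet a ha ha0
  have h5 : b / q * (M / 2) ≤ ‖T (intVec a)‖ := le_trans (by gcongr) h4
  have h6 : ‖T (intVec a)‖ ≤ M * ‖T u‖ + S.card * (4 * b / 2) := by
    have : T (intVec a) = M • T u + T (intVec a - M • u) := by simp
    rw [this]
    refine (norm_add_le _ _).trans (add_le_add ?_ h1)
    rw [norm_smul, Real.norm_of_nonneg (by positivity)]
  rw [hMv] at h5 h6
  have h7 : b / q * (8 * q * S.card / 2) = 4 * b * S.card := by field_simp; ring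
  rw [div_le_iff₀ (by positivity)]
  rw [h7] at h5
  have : S.card * b ≤ S.card * (‖T u‖ * (4 * q)) := by nlinarith
  exact le_of_mul_le_mul_left this (by linarith)

theorem inner_map_single_le_of_latticeNet {T : EuclideanSpace ℝ (Fin p) →ₗ[ℝ] F} {t : ℝ}
    (ht : 0 ≤ t) {S : Finset (Fin p)} (hS0 : S.Nonempty) {M : ℕ} (hM : S.card ≤ M) {j : Fin p}
    (hnet : ∀ a ∈ latticeNet S M, a ≠ 0 → a j = 0 →
      inner ℝ (T (EuclideanSpace.single j 1)) (T (intVec a)) ≤ t * ‖intVec a‖)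
    {v : EuclideanSpace ℝ (Fin p)} (hS : ∀ k ∉ S, v k = 0) (hj : v j = 0) :
    inner ℝ (T (EuclideanSpace.single j 1)) (T v) ≤ 3 * t * ‖v‖ := by
  set y : EuclideanSpace ℝ (Fin p) := WithLp.toLp 2 fun k =>
    if k ∈ S ∧ k ≠ j then
      inner ℝ (T (EuclideanSpace.single j 1)) (T (EuclideanSpace.single k 1)) else 0 with hy
  have hyS : ∀ k ∉ S, y k = 0 := fun k hk => by simp [hy, hk]
  have hyj : y j = 0 := by simp [hy]
  have key : ∀ w : EuclideanSpace ℝ (Fin p), (∀ k ∉ S, w k = 0) → w j = 0 →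
      inner ℝ (T (EuclideanSpace.single j 1)) (T w) = inner ℝ y w := by
    intro w hw hwj
    rw [map_eq_sum_smul_single T w, inner_sum, PiLp.inner_apply]
    refine Finset.sum_congr rfl fun k _ => ?_
    rw [inner_smul_right]
    by_cases hk : k ∈ S ∧ k ≠ j
    · simp [hy, hk]
    · have : w k = 0 := by
        by_cases hkS : k ∈ S
        · rw [show k = j by tauto, hwj]
        · exact hw k hkS
      simp [this]
  rw [key v hS hj]
  refine (real_inner_le_norm y v).trans ?_
  refine mul_le_mul_of_nonneg_right ?_ (norm_nonneg v)
  rcases eq_or_ne y 0 with h0 | h0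
  · rw [h0, norm_zero]; positivity
  have hy0 : 0 < ‖y‖ := norm_pos_iff.2 h0
  set u := ‖y‖⁻¹ • y with hu
  have hu1 : ‖u‖ = 1 := by simp [hu, norm_smul, hy0.ne']
  have huS : ∀ k ∉ S, u k = 0 := fun k hk => by simp [hu, hyS k hk]
  have huj : u j = 0 := by simp [hu, hyj]
  obtain ⟨a, ha, hau, hd⟩ := exists_latticeNet_near hu1 huS M
  have hdS : ∀ k ∉ S, (intVec a - (M : ℝ) • u) k = 0 := fun k hk => by
    simp [intVec, huS k hk, hau k (huS k hk)]
  have h2 := norm_le_of_abs_le_half hdS hd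
  have hs : (1 : ℝ) ≤ S.card := by exact_mod_cast hS0.card_pos
  have hM' : (S.card : ℝ) ≤ M := by exact_mod_cast hM
  have hMu : ‖(M : ℝ) • u‖ = M := by
    rw [norm_smul, hu1, mul_one, Real.norm_of_nonneg (by positivity)]
  have h3 := norm_sub_norm_le ((M : ℝ) • u) (intVec a)
  have h3' := norm_sub_norm_le (intVec a) ((M : ℝ) • u)
  rw [norm_sub_rev] at h3
  rw [hMu] at h3 h3'
  have ha0 : a ≠ 0 := by
    rintro rfl
    have : intVec (0 : Fin p → ℤ) = 0 := by ext j; simp [intVec]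
    rw [this, norm_zero, ← this] at h3
    linarith
  have h4 := hnet a ha ha0 (hau j huj)
  rw [key _ (fun k hk => by simp [intVec, hau k (huS k hk)]) (by simp [intVec, hau j huj])] at h4
  have h5 : inner ℝ y (intVec a) = M * ‖y‖ + inner ℝ y (intVec a - (M : ℝ) • u) := by
    rw [inner_sub_right, inner_smul_right, hu, inner_smul_right, real_inner_self_eq_norm_sq]
    field_simp
    ring
  have h6 := neg_le_of_abs_le (abs_real_inner_le_norm y (intVec a - (M : ℝ) • u))
  have h7 : ‖y‖ * ‖intVec a - (M : ℝ) • u‖ ≤ ‖y‖ * (M / 2) := by gcongr; linarith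
  have h8 : t * ‖intVec a‖ ≤ t * (3 * M / 2) := by gcongr; linarith
  have : ‖y‖ * (M / 2) ≤ 3 * t * (M / 2) := by linarith
  exact le_of_mul_le_mul_right this (by linarith)

end Deterministic

/-- Extension by zero of a vector indexed by `S`. -/
noncomputable def extendZero {p : ℕ} {S : Finset (Fin p)} (v : S → ℝ) :
    EuclideanSpace ℝ (Fin p) :=
  WithLp.toLp 2 fun j => if h : j ∈ S then v ⟨j, h⟩ else 0

theorem sum_extendZero_smul {p : ℕ} {S : Finset (Fin p)} {F : Type*} [AddCommGroup F] [Module ℝ F]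
    (v : S → ℝ) (f : Fin p → F) : ∑ j, extendZero v j • f j = ∑ j : S, v j • f j := by
  rw [← Finset.sum_subset S.subset_univ (by intro j _ hj; simp [extendZero, hj]),
    ← Finset.sum_coe_sort S]
  simp [extendZero]

theorem norm_extendZero_sq {p : ℕ} {S : Finset (Fin p)} (v : S → ℝ) :
    ‖extendZero v‖ ^ 2 = ∑ j, v j ^ 2 := by
  rw [EuclideanSpace.real_norm_sq_eq]
  calc ∑ j, extendZero v j ^ 2 = ∑ j, extendZero v j • extendZero v j := by
        simp only [sq, smul_eq_mul]
    _ = ∑ j : S, v j • extendZero v j := sum_extendZero_smul v _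
    _ = ∑ j, v j ^ 2 := by simp [extendZero, sq]

theorem gram_apply_eq_inner {n p : ℕ} (x : Fin n → Fin p → ℝ) (S : Finset (Fin p)) (j k : S) :
    gram S x j k = inner ℝ (toEuclideanLin (of x) (EuclideanSpace.single j.1 1))
      (toEuclideanLin (of x) (EuclideanSpace.single k.1 1)) := by
  simp [_root_.gram, PiLp.inner_apply, mul_comm]

theorem gram_mulVec_eq_inner {n p : ℕ} (x : Fin n → Fin p → ℝ) (S : Finset (Fin p)) (v : S → ℝ)
    (j : S) : (gram S x *ᵥ v) j =
      inner ℝ (toEuclideanLin (of x) (EuclideanSpace.single j.1 1))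
        (toEuclideanLin (of x) (extendZero v)) := by
  rw [map_eq_sum_smul_single _ (extendZero v), sum_extendZero_smul, inner_sum]
  simp only [mulVec, dotProduct, gram_apply_eq_inner, inner_smul_right]
  exact Finset.sum_congr rfl fun k _ => mul_comm _ _

theorem dotProduct_gram_mulVec {n p : ℕ} (x : Fin n → Fin p → ℝ) (S : Finset (Fin p))
    (v : S → ℝ) : v ⬝ᵥ (gram S x *ᵥ v) = ‖toEuclideanLin (of x) (extendZero v)‖ ^ 2 := by
  rw [← real_inner_self_eq_norm_sq]
  conv_rhs => rw [map_eq_sum_smul_single _ (extendZero v), sum_extendZero_smul, sum_inner]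
  refine Finset.sum_congr rfl fun j _ => ?_
  rw [gram_mulVec_eq_inner, real_inner_smul_left, map_eq_sum_smul_single _ (extendZero v),
    sum_extendZero_smul]

theorem gram_inverse_bound {n p : ℕ} {x : Fin n → Fin p → ℝ} {S : Finset (Fin p)} {c t r : ℝ}
    (hc : 0 < c) (ht : 0 ≤ t) (hr : 0 ≤ r)
    (hlow : ∀ v : EuclideanSpace ℝ (Fin p), (∀ j ∉ S, v j = 0) →
      c * ‖v‖ ^ 2 ≤ ‖toEuclideanLin (of x) v‖ ^ 2)
    (hinner : ∀ j ∈ S, ∀ v : EuclideanSpace ℝ (Fin p), (∀ k ∉ S, v k = 0) → v j = 0 →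
      inner ℝ (toEuclideanLin (of x) (EuclideanSpace.single j 1)) (toEuclideanLin (of x) v)
        ≤ t * ‖v‖)
    (htr : t * √S.card ≤ r * c) (hS : S.Nonempty) :
    IsUnit (gram S x).det ∧ matNormInf (gram S x)⁻¹ ≤ (1 + r) / c := by
  have hext (v : S → ℝ) : ∀ j ∉ S, extendZero v j = 0 := fun j hj => by simp [extendZero, hj]
  have hunit : IsUnit (gram S x).det := by
    rw [← isUnit_iff_isUnit_det, ← mulVec_injective_iff_isUnit,
      ← Matrix.coe_mulVecLin, injective_iff_map_eq_zero]
    intro v hv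
    rw [mulVecLin_apply] at hv
    have h1 := dotProduct_gram_mulVec x S v
    rw [hv, dotProduct_zero] at h1
    have h2 := hlow _ (hext v)
    rw [← h1, norm_extendZero_sq] at h2
    have h3 : ∑ j, v j ^ 2 = 0 := le_antisymm
      (nonpos_of_mul_nonpos_right h2 hc) (Finset.sum_nonneg fun _ _ => sq_nonneg _)
    ext j
    have := (Finset.sum_eq_zero_iff_of_nonneg fun _ _ => sq_nonneg _).1 h3 j (Finset.mem_univ j)
    simpa using this
  refine ⟨hunit, ?_⟩
  have : Nonempty S := hS.to_subtype
  refine ciSup_le fun i => ?_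
  -- The row sum is the `i`-th entry of the solution `v` of `G v = ε` with `ε` a sign vector.
  set ε : S → ℝ := fun j => SignType.sign ((gram S x)⁻¹ i j) with hε
  have hε1 : ∀ j, |ε j| ≤ 1 := fun j => by
    rcases lt_trichotomy ((gram S x)⁻¹ i j) 0 with h | h | h <;> simp [hε, h]
  set v := (gram S x)⁻¹ *ᵥ ε with hv
  have hvi : ∑ j, |(gram S x)⁻¹ i j| = v i := by
    simp only [hv, mulVec, dotProduct, hε]
    exact Finset.sum_congr rfl fun j _ => (self_mul_sign _).symm
  have hGv : gram S x *ᵥ v = ε := by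
    rw [hv, mulVec_mulVec, mul_nonsing_inv _ hunit, one_mulVec]
  rw [hvi]
  have hnv : c * ‖extendZero v‖ ≤ √S.card := by
    have h1 := hlow _ (hext v)
    rw [← dotProduct_gram_mulVec, hGv] at h1
    have h2 : v ⬝ᵥ ε ≤ ‖extendZero v‖ * √S.card := by
      refine (Real.sum_mul_le_sqrt_mul_sqrt _ _ _).trans ?_
      rw [← norm_extendZero_sq, sqrt_sq (norm_nonneg _)]
      gcongr
      refine (Finset.sum_le_card_nsmul _ _ 1 fun j _ => ?_).trans (by simp)
      rw [← sq_abs]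
      exact pow_le_one₀ (abs_nonneg _) (hε1 j)
    rcases (norm_nonneg (extendZero v)).eq_or_lt' with h0 | h0
    · rw [h0, mul_zero]; exact sqrt_nonneg _
    · have : (c * ‖extendZero v‖) * ‖extendZero v‖ ≤ √S.card * ‖extendZero v‖ := by
        nlinarith
      exact le_of_mul_le_mul_right this h0
  set e : EuclideanSpace ℝ (Fin p) := EuclideanSpace.single i.1 1 with he
  set w := v i • e - extendZero v with hw
  have hwS : ∀ k ∉ S, w k = 0 := fun k hk => by
    have : k ≠ i := fun h => hk (h ▸ i.2)
    simp [hw, he, hext v k hk, this]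
  have hwi : w i = 0 := by simp [hw, he, extendZero]
  have hwn : ‖w‖ ≤ ‖extendZero v‖ := by
    refine le_of_sq_le_sq ?_ (norm_nonneg _)
    rw [EuclideanSpace.real_norm_sq_eq, EuclideanSpace.real_norm_sq_eq]
    refine Finset.sum_le_sum fun k _ => ?_
    by_cases hk : k = i.1
    · rw [hk, hwi, zero_pow two_ne_zero]; exact sq_nonneg _
    · simp [hw, he, hk]
  have h1 := hinner i i.2 w hwS hwi
  have h2 := gram_mulVec_eq_inner x S v i
  rw [hGv] at h2
  have h3 := hlow e (fun k hk => by
    have : k ≠ i := fun h => hk (h ▸ i.2)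
    simp [he, this])
  rw [hw, map_sub, inner_sub_right, ← h2, map_smul, inner_smul_right,
    real_inner_self_eq_norm_sq, ← hw] at h1
  rw [show ‖e‖ = 1 by simp [he], one_pow, mul_one] at h3
  have h4 := (abs_le.1 (hε1 i)).2
  rw [le_div_iff₀ hc]
  rcases le_total (v i) 0 with h0 | h0
  · nlinarith
  · have h5 : v i * c ≤ v i * ‖toEuclideanLin (of x) e‖ ^ 2 := by gcongr
    have h6 : t * ‖w‖ ≤ r := by
      have : t * ‖w‖ * c ≤ r * c := by
        calc t * ‖w‖ * c ≤ t * (c * ‖extendZero v‖) := by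
              rw [mul_assoc, mul_comm c]; gcongr
          _ ≤ t * √S.card := by gcongr
          _ ≤ r * c := htr
      exact le_of_mul_le_mul_right this hc
    linarith

instance isProbabilityMeasure_gaussMat (n p : ℕ) : IsProbabilityMeasure (gaussMat n p) := by
  unfold gaussMat; infer_instance

theorem norm_intVec_pos {p : ℕ} {a : Fin p → ℤ} (ha : a ≠ 0) : 0 < ‖intVec a‖ := by
  rw [norm_pos_iff]
  refine fun h => ha (funext fun j => ?_)
  simpa [intVec] using congrArg (fun v : EuclideanSpace ℝ (Fin p) => v j) h

theorem gaussMat_real_norm_map_lt {n p : ℕ} {A : EuclideanSpace ℝ (Fin p)} (hA : 0 < ‖A‖)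
    {q : ℕ} (hq : 0 < q) :
    (gaussMat n p).real {x | ‖toEuclideanLin (of x) A‖ ^ 2 < n / q ^ 2 * ‖A‖ ^ 2}
      ≤ (exp 1 / q) ^ n := by
  have hq' : (0 : ℝ) < q := by exact_mod_cast hq
  have h := gaussMat_real_mul_le_mul_norm_sq (n := n) (‖A‖⁻¹ • A)
    (by simp [norm_smul, hA.ne']) (l := -((q : ℝ) ^ 2 / 2)) (by nlinarith) (n / q ^ 2)
  refine (measureReal_mono fun x hx => ?_).trans (h.trans ?_)
  · have hx' : ‖toEuclideanLin (of x) A‖ ^ 2 < n / q ^ 2 * ‖A‖ ^ 2 := hx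
    rw [Set.mem_ofPred_eq, map_smul, norm_smul, norm_inv, norm_norm, mul_pow, inv_pow,
      inv_mul_eq_div]
    refine mul_le_mul_of_nonpos_left ?_ (by nlinarith)
    rw [div_le_iff₀ (by positivity)]
    exact hx'.le
  · rw [div_pow, div_eq_mul_inv (exp 1 ^ n), ← inv_pow (q : ℝ)]
    gcongr
    · rw [← exp_nat_mul, exp_le_exp]
      field_simp
      linarith [(Nat.cast_nonneg n : (0 : ℝ) ≤ n)]
    · apply le_sqrt_of_sq_le
      linarith

theorem gaussMat_real_lt_inner {n p : ℕ} {A : EuclideanSpace ℝ (Fin p)} (hA : 0 < ‖A‖)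
    {j : Fin p} (hj : A j = 0) {l : ℝ} (hl0 : 0 < l) (hl : l ≤ 1 / 4) (t : ℝ) :
    (gaussMat n p).real {x | t * ‖A‖ < inner ℝ
      (toEuclideanLin (of x) (EuclideanSpace.single j 1)) (toEuclideanLin (of x) A)}
      ≤ 2 * exp (4 * l ^ 2 * n - l * t) := by
  set e : EuclideanSpace ℝ (Fin p) := EuclideanSpace.single j 1 with he
  set u := ‖A‖⁻¹ • A with hu
  have hu1 : ‖u‖ = 1 := by simp [hu, norm_smul, hA.ne']
  have he1 : ‖e‖ = 1 := by simp [he]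
  have heu : inner ℝ e u = 0 := by simp [he, hu, EuclideanSpace.inner_single_left, hj]
  have hsq : ‖(√2)⁻¹‖ ^ 2 = 1 / 2 := by
    rw [Real.norm_eq_abs, sq_abs, inv_pow, sq_sqrt (by norm_num)]; norm_num
  have hp : ‖(√2)⁻¹ • (e + u)‖ = 1 := by
    rw [← sq_eq_sq₀ (norm_nonneg _) zero_le_one, norm_smul, mul_pow, hsq, norm_add_sq_real, heu,
      hu1, he1]
    norm_num
  have hm : ‖(√2)⁻¹ • (e - u)‖ = 1 := by
    rw [← sq_eq_sq₀ (norm_nonneg _) zero_le_one, norm_smul, mul_pow, hsq, norm_sub_sq_real, heu,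
      hu1, he1]
    norm_num
  have h1 := gaussMat_real_mul_le_mul_norm_sq_of_le (n := n) _ hp hl (n + t)
  have h2 := gaussMat_real_mul_le_mul_norm_sq_of_le (n := n) _ hm (l := -l) (by linarith) (n - t)
  have e1 : (n : ℝ) * (l + 4 * l ^ 2) - l * (n + t) = 4 * l ^ 2 * n - l * t := by ring
  have e2 : (n : ℝ) * (-l + 4 * (-l) ^ 2) - -l * (n - t) = 4 * l ^ 2 * n - l * t := by ring
  rw [e1] at h1
  rw [e2] at h2
  refine (measureReal_mono (fun x hx => ?_)).trans
    ((measureReal_union_le _ _).trans ((add_le_add h1 h2).trans (by linarith)))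
  have hx' : t * ‖A‖ < inner ℝ (toEuclideanLin (of x) e) (toEuclideanLin (of x) A) := hx
  have hxu : t < inner ℝ (toEuclideanLin (of x) e) (toEuclideanLin (of x) u) := by
    rw [hu, map_smul, inner_smul_right, inv_mul_eq_div, lt_div_iff₀ hA]
    exact hx'
  by_contra hcon
  simp only [Set.mem_union, Set.mem_ofPred_eq, not_or, not_le, map_smul, norm_smul, mul_pow, hsq,
    map_add, map_sub, norm_add_sq_real, norm_sub_sq_real] at hcon
  nlinarith [hcon.1, hcon.2]

/-- The event on which every column is short, columns are almost orthogonal to lattice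
combinations of few other columns, and lattice combinations of few columns are long. -/
structure IsWellConditioned {n p : ℕ} (s q : ℕ) (t : ℝ) (x : Fin n → Fin p → ℝ) : Prop where
  col : ∀ j, ‖toEuclideanLin (of x) (EuclideanSpace.single j 1)‖ ^ 2 ≤ 16 * n
  inner : ∀ S ∈ Finset.powersetCard s Finset.univ, ∀ a ∈ latticeNet S (8 * q * s), ∀ j,
    a ≠ 0 → a j = 0 → inner ℝ (toEuclideanLin (of x) (EuclideanSpace.single j 1))
      (toEuclideanLin (of x) (intVec a)) ≤ t * ‖intVec a‖
  lower : ∀ S ∈ Finset.powersetCard s Finset.univ, ∀ a ∈ latticeNet S (8 * q * s),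
    a ≠ 0 → n / q ^ 2 * ‖intVec a‖ ^ 2 ≤ ‖toEuclideanLin (of x) (intVec a)‖ ^ 2

theorem gaussMat_real_not_isWellConditioned {n p : ℕ} (s : ℕ) {q : ℕ} (hq : 0 < q)
    {l : ℝ} (hl0 : 0 < l) (hl : l ≤ 1 / 4) (t : ℝ) :
    (gaussMat n p).real {x | ¬ IsWellConditioned s q t x} ≤
      p * exp (-(7 / 2 * n))
      + (p.choose s * (16 * q * s + 1) ^ s * p) * (2 * exp (4 * l ^ 2 * n - l * t))
      + (p.choose s * (16 * q * s + 1) ^ s) * (exp 1 / q) ^ n := by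
  set B1 : Fin p → Set (Fin n → Fin p → ℝ) := fun j =>
    {x | 16 * n < ‖toEuclideanLin (of x) (EuclideanSpace.single j 1)‖ ^ 2} with hB1
  set B2 : (Fin p → ℤ) → Fin p → Set (Fin n → Fin p → ℝ) := fun a j =>
    {x | a ≠ 0 ∧ a j = 0 ∧ t * ‖intVec a‖ < inner ℝ
      (toEuclideanLin (of x) (EuclideanSpace.single j 1))
      (toEuclideanLin (of x) (intVec a))} with hB2
  set B3 : (Fin p → ℤ) → Set (Fin n → Fin p → ℝ) := fun a =>
    {x | a ≠ 0 ∧ ‖toEuclideanLin (of x) (intVec a)‖ ^ 2 < n / q ^ 2 * ‖intVec a‖ ^ 2} with hB3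
  have hsub : {x : Fin n → Fin p → ℝ | ¬ IsWellConditioned s q t x} ⊆ ((⋃ j ∈ Finset.univ, B1 j)
      ∪ ⋃ S ∈ Finset.powersetCard s Finset.univ, ⋃ a ∈ latticeNet S (8 * q * s),
          ⋃ j ∈ Finset.univ, B2 a j)
      ∪ ⋃ S ∈ Finset.powersetCard s Finset.univ, ⋃ a ∈ latticeNet S (8 * q * s), B3 a := by
    intro x hx
    by_contra hcon
    refine hx ⟨fun j => ?_, fun S hS a ha j h0 hj => ?_, fun S hS a ha h0 => ?_⟩ <;>
    by_contra! hlt <;> refine hcon ?_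
    · exact .inl (.inl (Set.mem_biUnion (Finset.mem_univ j) hlt))
    · exact .inl (.inr (Set.mem_biUnion hS (Set.mem_biUnion ha
        (Set.mem_biUnion (Finset.mem_univ j) ⟨h0, hj, hlt⟩))))
    · exact .inr (Set.mem_biUnion hS (Set.mem_biUnion ha ⟨h0, hlt⟩))
  have hb1 (j) : (gaussMat n p).real (B1 j) ≤ exp (-(7 / 2 * n)) := by
    have h := gaussMat_real_mul_le_mul_norm_sq_of_le (n := n)
      (EuclideanSpace.single j (1 : ℝ)) (by simp) (l := 1 / 4) le_rfl (16 * n)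
    refine (measureReal_mono fun x hx => ?_).trans (h.trans (exp_le_exp.2 (by linarith)))
    have hx' : 16 * n < ‖toEuclideanLin (of x) (EuclideanSpace.single j 1)‖ ^ 2 := hx
    rw [Set.mem_ofPred_eq]
    linarith
  have hb2 (a j) : (gaussMat n p).real (B2 a j) ≤ 2 * exp (4 * l ^ 2 * n - l * t) := by
    by_cases h : a ≠ 0 ∧ a j = 0
    · refine (measureReal_mono fun x hx => ?_).trans
        (gaussMat_real_lt_inner (norm_intVec_pos h.1) (j := j) (by simp [intVec, h.2]) hl0 hl t)
      exact hx.2.2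
    · have : B2 a j = ∅ := Set.eq_empty_of_forall_notMem fun x hx => h ⟨hx.1, hx.2.1⟩
      rw [this, measureReal_empty]; positivity
  have hb3 (a) : (gaussMat n p).real (B3 a) ≤ (exp 1 / q) ^ n := by
    by_cases h : a ≠ 0
    · refine (measureReal_mono fun x hx => ?_).trans
        (gaussMat_real_norm_map_lt (norm_intVec_pos h) hq)
      exact hx.2
    · have : B3 a = ∅ := Set.eq_empty_of_forall_notMem fun x hx => h hx.1
      rw [this, measureReal_empty]; positivity
  have hcard : ∀ S ∈ Finset.powersetCard s (Finset.univ : Finset (Fin p)),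
      ((latticeNet S (8 * q * s)).card : ℝ) = (16 * q * s + 1) ^ s := by
    intro S hS
    rw [card_latticeNet, (Finset.mem_powersetCard.1 hS).2]
    push_cast
    ring
  refine (measureReal_mono hsub).trans ((measureReal_union_le _ _).trans (add_le_add
    ((measureReal_union_le _ _).trans (add_le_add ?_ ?_)) ?_))
  · refine (measureReal_biUnion_finset_le _ _).trans
      ((Finset.sum_le_card_nsmul _ _ _ fun j _ => hb1 j).trans ?_)
    simp
  · refine (measureReal_biUnion_finset_le _ _).trans
      ((Finset.sum_le_card_nsmul _ _ ((16 * q * s + 1) ^ s * (p * (2 * exp (4 * l ^ 2 * n - l * t))))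
        fun S hS => ?_).trans ?_)
    · refine (measureReal_biUnion_finset_le _ _).trans ((Finset.sum_le_card_nsmul _ _
        (p * (2 * exp (4 * l ^ 2 * n - l * t))) fun a _ => ?_).trans ?_)
      · refine (measureReal_biUnion_finset_le _ _).trans
          ((Finset.sum_le_card_nsmul _ _ _ fun j _ => hb2 a j).trans ?_)
        simp
      · rw [nsmul_eq_mul, hcard S hS]
    · rw [nsmul_eq_mul, Finset.card_powersetCard, Finset.card_univ, Fintype.card_fin]
      exact le_of_eq (by ring)
  · refine (measureReal_biUnion_finset_le _ _).trans
      ((Finset.sum_le_card_nsmul _ _ ((16 * q * s + 1) ^ s * (exp 1 / q) ^ n)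
        fun S hS => ?_).trans ?_)
    · refine (measureReal_biUnion_finset_le _ _).trans
        ((Finset.sum_le_card_nsmul _ _ _ fun a _ => hb3 a).trans ?_)
      rw [nsmul_eq_mul, hcard S hS]
    · rw [nsmul_eq_mul, Finset.card_powersetCard, Finset.card_univ, Fintype.card_fin]
      exact le_of_eq (by ring)

theorem IsWellConditioned.gram_inverse_bound {n p s q : ℕ} {L : ℝ} {x : Fin n → Fin p → ℝ}
    (hx : IsWellConditioned s q (73 * √(n * (s * L))) x) (hn : 1 ≤ n) (hsp : s ≤ p) (hq : 0 < q)
    (hL : (s : ℝ) ^ 2 * L ≤ n) {S : Finset (Fin p)} (hS : S.Nonempty) (hSs : S.card ≤ s) :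
    IsUnit (gram S x).det ∧
      matNormInf (gram S x)⁻¹ ≤ (1 + 219 * (16 * q ^ 2)) * (16 * q ^ 2) / n := by
  obtain ⟨S', hSS', -, hS'⟩ := Finset.exists_subsuperset_card_eq S.subset_univ hSs
    (by simpa using hsp)
  have hmem : S' ∈ Finset.powersetCard s Finset.univ := by simp [hS']
  have hn' : (0 : ℝ) < n := by exact_mod_cast hn
  have hq' : (0 : ℝ) < q := by exact_mod_cast hq
  have hsub {v : EuclideanSpace ℝ (Fin p)} (hv : ∀ j ∉ S, v j = 0) : ∀ j ∉ S', v j = 0 :=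
    fun j hj => hv j fun h => hj (hSS' h)
  have h := _root_.gram_inverse_bound (x := x) (S := S) (c := n / (16 * q ^ 2))
    (t := 3 * (73 * √(n * (s * L)))) (r := 219 * (16 * q ^ 2)) (by positivity) (by positivity)
    (by positivity) ?_ ?_ ?_ hS
  · rwa [div_div_eq_mul_div] at h
  · intro v hv
    have h := le_norm_map_of_latticeNet (T := toEuclideanLin (of x)) (sqrt_nonneg n) (fun j => ?_)
      (hS.mono hSS') hq (fun a ha h0 => ?_) (hsub hv)
    · have := pow_le_pow_left₀ (by positivity) h 2
      rw [mul_pow, div_pow, sq_sqrt hn'.le, mul_pow] at this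
      norm_num at this
      exact this
    · refine le_of_sq_le_sq ?_ (by positivity)
      rw [mul_pow, sq_sqrt hn'.le]
      norm_num
      exact hx.col j
    · rw [hS'] at ha
      refine le_of_sq_le_sq ?_ (by positivity)
      rw [mul_pow, div_pow, sq_sqrt hn'.le]
      exact hx.lower S' hmem a ha h0
  · intro j _ v hv hj
    refine inner_map_single_le_of_latticeNet (by positivity) (hS.mono hSS') (M := 8 * q * s) ?_
      (fun a ha h0 haj => hx.inner S' hmem a ha j h0 haj) (hsub hv) hj
    rw [hS']
    nlinarith
  · have h1 : √(n * (s * L)) * √S.card ≤ n := by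
      rw [← sqrt_mul' _ (Nat.cast_nonneg _)]
      apply sqrt_le_iff.2 ⟨hn'.le, ?_⟩
      have hSs' : (S.card : ℝ) ≤ s := by exact_mod_cast hSs
      rcases le_total L 0 with h0 | h0
      · refine le_trans ?_ (sq_nonneg (n : ℝ))
        refine mul_nonpos_of_nonpos_of_nonneg ?_ (by positivity)
        exact mul_nonpos_of_nonneg_of_nonpos hn'.le
          (mul_nonpos_of_nonneg_of_nonpos (by positivity) h0)
      · calc n * (s * L) * S.card ≤ n * (s * L) * s := by gcongr
          _ = n * (s ^ 2 * L) := by ring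
          _ ≤ n * n := by gcongr
          _ = (n : ℝ) ^ 2 := by ring
    rw [mul_assoc (219 : ℝ), mul_div_cancel₀ _ (by positivity)]
    linarith

theorem gaussMat_real_not_isWellConditioned_le {n p s : ℕ} (hs : 1 ≤ s) (hsp : s ≤ p) (hp : 3 ≤ p)
    (h : (s : ℝ) ^ 2 * log p ≤ n) :
    (gaussMat n p).real {x | ¬ IsWellConditioned s 100000 (73 * √(n * (s * log p))) x} ≤
      4 * exp (-(s * log p)) := by
  have hp' : (3 : ℝ) ≤ p := by exact_mod_cast hp
  have hs' : (1 : ℝ) ≤ s := by exact_mod_cast hs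
  have hsp' : (s : ℝ) ≤ p := by exact_mod_cast hsp
  have he := exp_one_lt_d9
  have hL1 : 1 < log p := by
    rw [lt_log_iff_exp_lt (by linarith)]
    linarith
  set L := log p
  set D := s * L with hD
  have hD0 : 0 < D := by positivity
  have hexpD : exp D = (p : ℝ) ^ s := by
    rw [hD, exp_nat_mul, exp_log (by linarith)]
  have hDn : D ≤ n := by nlinarith
  have hn0 : (0 : ℝ) < n := hD0.trans_le hDn
  have hsn : 2 * s ≤ n := by
    have : s ^ 2 < n := by
      have : (s : ℝ) ^ 2 < n := by nlinarith
      exact_mod_cast this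
    rcases hs.eq_or_lt with rfl | h2
    · omega
    · nlinarith
  have hpD : (p : ℝ) ≤ exp D := by
    rw [hexpD]; exact le_self_pow₀ (by linarith) (by omega)
  have hchoose : (p.choose s : ℝ) ≤ exp D := by
    rw [hexpD]; exact_mod_cast Nat.choose_le_pow p s
  have hnet : (16 * (100000 : ℕ) * s + 1 : ℝ) ^ s ≤ 1700000 ^ s * exp D := by
    rw [hexpD, ← mul_pow]
    gcongr
    push_cast
    linarith
  set l := √(D / n) / 4 with hl
  have hl0 : 0 < l := by positivity
  have hl1 : l ≤ 1 / 4 := by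
    have : √(D / n) ≤ 1 := by
      rw [sqrt_le_one, div_le_one hn0]
      exact hDn
    linarith
  have hexp : 4 * l ^ 2 * n - l * (73 * √(n * D)) = -(18 * D) := by
    have h1 : √(D / n) * √(n * D) = D := by
      rw [← sqrt_mul (by positivity), show D / n * (n * D) = D ^ 2 by field_simp,
        sqrt_sq hD0.le]
    have h2 : l ^ 2 * n = D / 16 := by
      rw [hl, div_pow, sq_sqrt (by positivity)]
      field_simp
      norm_num
    have h3 : l * (73 * √(n * D)) = 73 / 4 * (√(D / n) * √(n * D)) := by rw [hl]; ring
    rw [h3, h1, mul_assoc, h2]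
    ring
  refine (gaussMat_real_not_isWellConditioned s (by norm_num) hl0 hl1 _).trans ?_
  rw [hexp]
  have b1 : (p : ℝ) * exp (-(7 / 2 * n)) ≤ exp (-D) := by
    calc (p : ℝ) * exp (-(7 / 2 * n)) ≤ exp D * exp (-(7 / 2 * n)) := by gcongr
      _ ≤ exp (-D) := by rw [← exp_add, exp_le_exp]; linarith
  have b2 : (p.choose s * (16 * (100000 : ℕ) * s + 1) ^ s * p : ℝ) * (2 * exp (-(18 * D)))
      ≤ 2 * exp (-D) := by
    have hq : (1700000 : ℝ) ^ s ≤ exp (14 * D) := by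
      rw [show 14 * D = ((14 : ℕ) : ℝ) * D by norm_num, exp_nat_mul, hexpD, ← pow_mul, mul_comm,
        pow_mul]
      gcongr
      calc (1700000 : ℝ) ≤ 3 ^ 14 := by norm_num
        _ ≤ p ^ 14 := by gcongr
    calc _ ≤ (exp D * (exp (14 * D) * exp D) * exp D) * (2 * exp (-(18 * D))) := by
          gcongr
          exact hnet.trans (by gcongr)
      _ = 2 * exp (-D) := by
          rw [mul_left_comm, ← exp_add, ← exp_add, ← exp_add, ← exp_add]
          ring_nf
  have b3 : (p.choose s * (16 * (100000 : ℕ) * s + 1) ^ s : ℝ) * (exp 1 / (100000 : ℕ)) ^ n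
      ≤ exp (-D) := by
    have hq : (1700000 : ℝ) ^ s ≤ 1304 ^ n := by
      calc (1700000 : ℝ) ^ s ≤ (1304 ^ 2) ^ s := by gcongr; norm_num
        _ = 1304 ^ (2 * s) := by rw [← pow_mul]
        _ ≤ 1304 ^ n := pow_le_pow_right₀ (by norm_num) hsn
    have hen : exp D ≤ exp 1 ^ n := by
      rw [← exp_nat_mul, exp_le_exp, mul_one]; exact hDn
    have h4 : exp 1 ^ 4 * 1304 / 100000 ≤ 1 := by
      have : exp 1 ^ 4 ≤ 2.7182818286 ^ 4 := by gcongr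
      norm_num at this ⊢
      linarith
    rw [exp_neg, ← one_div, le_div_iff₀ (exp_pos _)]
    calc _ ≤ (exp 1 ^ n * (1304 ^ n * exp 1 ^ n)) * (exp 1 / (100000 : ℕ)) ^ n * exp 1 ^ n := by
          gcongr
          · exact hchoose.trans hen
          · exact hnet.trans (by gcongr)
      _ = (exp 1 ^ 4 * 1304 / 100000) ^ n := by
          rw [← mul_pow, ← mul_pow, ← mul_pow, ← mul_pow]
          congr 1
          push_cast
          ring
      _ ≤ 1 := pow_le_one₀ (by positivity) h4
  exact (add_le_add (add_le_add b1 b2) b3).trans (by linarith)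

/-- uniform bound on `‖(X_SᵀX_S)⁻¹‖_∞` for sparse supports. -/
theorem stmt_7 : ∃ K : ℝ, 0 < K ∧
    ∀ n p sstar : ℕ, 1 ≤ n → 1 ≤ sstar → sstar ≤ p → 3 ≤ p →
      (sstar : ℝ) ^ 2 * Real.log p ≤ (n : ℝ) →
      1 - ENNReal.ofReal (6 * (p : ℝ) ^ (-(sstar : ℝ))) ≤
        gaussMat n p {x | ∀ S : Finset (Fin p), S.Nonempty → S.card ≤ sstar →
          IsUnit (gram S x).det ∧ matNormInf (gram S x)⁻¹ ≤ K / n} := by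
  refine ⟨(1 + 219 * (16 * (100000 : ℕ) ^ 2)) * (16 * (100000 : ℕ) ^ 2), by positivity, ?_⟩
  intro n p s hn hs hsp hp h
  have hbad := gaussMat_real_not_isWellConditioned_le hs hsp hp h
  have hp0 : (0 : ℝ) < p := by positivity
  rw [show exp (-(s * log p)) = (p : ℝ) ^ (-(s : ℝ)) by rw [rpow_def_of_pos hp0]; ring_nf] at hbad
  set G := {x : Fin n → Fin p → ℝ | ∀ S : Finset (Fin p), S.Nonempty → S.card ≤ s →
    IsUnit (gram S x).det ∧ matNormInf (gram S x)⁻¹ ≤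
      (1 + 219 * (16 * (100000 : ℕ) ^ 2)) * (16 * (100000 : ℕ) ^ 2) / n} with hG
  set W := {x : Fin n → Fin p → ℝ |
    ¬ IsWellConditioned s 100000 (73 * √(n * (s * log p))) x}
  have hcover : Set.univ ⊆ G ∪ W := by
    intro x _
    by_cases hx : IsWellConditioned s 100000 (73 * √(n * (s * log p))) x
    · exact .inl fun S hS hSs => hx.gram_inverse_bound hn hsp (by norm_num) h hS hSs
    · exact .inr hx
  rw [tsub_le_iff_right]
  calc (1 : ENNReal) = gaussMat n p Set.univ := measure_univ.symm
    _ ≤ gaussMat n p G + gaussMat n p W := (measure_mono hcover).trans (measure_union_le _ _)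
    _ ≤ gaussMat n p G + ENNReal.ofReal (6 * (p : ℝ) ^ (-(s : ℝ))) := by
        gcongr
        rw [← ofReal_measureReal]
        refine ENNReal.ofReal_le_ofReal (hbad.trans ?_)
        gcongr
        norm_num
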